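/- Let p be an odd prime, q = p^r with q ≡ 1 (mod 4), and s = v₂(q−1). Then for every n ≥ 1, every Sylow 2-subgroup of GL_n(F_q) is isomorphic to the semidirect product Cⁿ ⋊ Q, where C is a cyclic group of order 2^s, Q is a Sylow 2-subgroup of the symmetric group S_n on n letters, and Q acts on the n-fold direct product Cⁿ by permuting the n coordinates. -/

import Mathlib

/-- The action of permutations on `n`-tuples in a group `C` by permuting the
coordinates: `(σ • f) i = f (σ⁻¹ i)`. -/
def permAction (n : ℕ) (C : Type*) [Group C] :
    Equiv.Perm (Fin n) →* MulAut (Fin n → C) :=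
  MonoidHom.mk'
    (fun σ =>
      { toFun := fun f => f ∘ σ.symm
        invFun := fun f => f ∘ σ
        left_inv := fun f => by ext i; simp
        right_inv := fun f => by ext i; simp
        map_mul' := fun f g => rfl })
    (fun σ τ => by ext f i; simp [Equiv.Perm.mul_def])

theorem padicValNat_two_pow_sub_one {q : ℕ} (hq : q % 4 = 1) (hq1 : 1 < q) {n : ℕ} (hn : n ≠ 0) :
    padicValNat 2 (q ^ n - 1) = padicValNat 2 (q - 1) + padicValNat 2 n := by
  have h := Int.two_pow_sub_pow' (x := q) (y := 1) n (by omega) (by omega)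
  have hpow : 1 < q ^ n := Nat.one_lt_pow hn hq1
  rw [← Nat.cast_inj (R := ℕ∞), Nat.cast_add, padicValNat_eq_emultiplicity (by omega),
    padicValNat_eq_emultiplicity (by omega), padicValNat_eq_emultiplicity hn,
    ← Int.natCast_emultiplicity, ← Int.natCast_emultiplicity, ← Int.natCast_emultiplicity,
    Nat.cast_sub hpow.le, Nat.cast_sub hq1.le]
  simpa using h

theorem factorization_two_prod_pow_sub_pow {q : ℕ} (hq : q % 4 = 1) (hq1 : 1 < q) (n : ℕ) :
    (∏ i : Fin n, (q ^ n - q ^ (i : ℕ))).factorization 2 =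
      n * padicValNat 2 (q - 1) + n.factorial.factorization 2 := by
  induction n with
  | zero => simp
  | succ n ih =>
    have hpos (n : ℕ) : ∏ i : Fin n, (q ^ n - q ^ (i : ℕ)) ≠ 0 :=
      Finset.prod_ne_zero_iff.mpr fun i _ =>
        (Nat.sub_pos_of_lt (Nat.pow_lt_pow_right hq1 i.isLt)).ne'
    have hstep : ∏ i : Fin (n + 1), (q ^ (n + 1) - q ^ (i : ℕ)) =
        (q ^ (n + 1) - 1) * (q ^ n * ∏ i : Fin n, (q ^ n - q ^ (i : ℕ))) := by
      rw [Fin.prod_univ_succ]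
      simp only [Fin.val_zero, pow_zero, Fin.val_succ, pow_succ, ← Nat.sub_mul]
      rw [Finset.prod_mul_distrib, Finset.prod_const, Finset.card_univ, Fintype.card_fin]
      ring
    have hpow : q ^ (n + 1) - 1 ≠ 0 :=
      (Nat.sub_pos_of_lt (Nat.one_lt_pow n.succ_ne_zero hq1)).ne'
    have hqn : q ^ n ≠ 0 := by positivity
    rw [hstep, Nat.factorization_mul hpow (mul_ne_zero hqn (hpos n)),
      Nat.factorization_mul hqn (hpos n), Nat.factorization_pow, Nat.factorial_succ,
      Nat.factorization_mul n.succ_ne_zero n.factorial_ne_zero]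
    simp only [Finsupp.add_apply, Finsupp.smul_apply, ih,
      Nat.factorization_eq_zero_of_not_dvd (show ¬2 ∣ q by omega),
      Nat.factorization_def _ Nat.prime_two, padicValNat_two_pow_sub_one hq hq1 n.succ_ne_zero]
    simp only [smul_zero]
    ring

/-- The monomial matrix attached to a tuple of scalars and a permutation, as a homomorphism from
the wreath product `Cⁿ ⋊ H`, for `C` mapping to the units of `F` and `H` a group of permutations. -/
def monomialHom {F C : Type*} [Field F] [Group C] {n : ℕ} (c : C →* Fˣ)
    (H : Subgroup (Equiv.Perm (Fin n))) :
    SemidirectProduct (Fin n → C) H ((permAction n C).comp H.subtype) →*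
      Matrix (Fin n) (Fin n) F where
  toFun x := Matrix.of fun i j =>
    if i = (x.right : Equiv.Perm (Fin n)) j then (c (x.left i) : F) else 0
  map_one' := by
    ext i j
    simp [Matrix.one_apply]
  map_mul' x y := by
    ext i j
    rw [SemidirectProduct.mul_left, SemidirectProduct.mul_right]
    by_cases h : i = (x.right : Equiv.Perm (Fin n)) ((y.right : Equiv.Perm (Fin n)) j) <;>
      simp [Matrix.mul_apply, permAction, h]

theorem monomialHom_injective {F C : Type*} [Field F] [Group C] {n : ℕ} {c : C →* Fˣ}
    (hc : Function.Injective c) (H : Subgroup (Equiv.Perm (Fin n))) :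
    Function.Injective (monomialHom c H) := by
  intro x y hxy
  have key (j : Fin n) := congrFun₂ hxy ((x.right : Equiv.Perm (Fin n)) j) j
  simp only [monomialHom, MonoidHom.coe_mk, OneHom.coe_mk, Matrix.of_apply, if_true] at key
  have hr : x.right = y.right := by
    ext1
    ext1 j
    by_contra h
    exact (c _).ne_zero ((key j).trans (if_neg h))
  refine SemidirectProduct.ext ?_ hr
  ext i
  obtain ⟨j, rfl⟩ := (x.right : Equiv.Perm (Fin n)).surjective i
  exact hc (Units.ext ((key j).trans (if_pos (by rw [hr]))))

theorem IsCyclic.exists_injective_zmod {G : Type*} [Group G] [Finite G] [IsCyclic G] {m : ℕ}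
    (hm : m ∣ Nat.card G) :
    ∃ c : Multiplicative (ZMod m) →* G, Function.Injective c := by
  obtain ⟨g, hg⟩ := IsCyclic.exists_ofOrder_eq_natCard (α := G)
  have ho : orderOf (g ^ (Nat.card G / m)) = m := by
    rw [← hg]
    exact orderOf_pow_orderOf_div (orderOf_pos g).ne' (hg ▸ hm)
  have hcard : Nat.card (Multiplicative (ZMod m)) =
      Nat.card (Subgroup.zpowers (g ^ (Nat.card G / m))) := by
    rw [Nat.card_zpowers, ho]
    exact Nat.card_zmod m
  exact ⟨(Subgroup.subtype _).comp (mulEquivOfCyclicCardEq hcard).toMonoidHom,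
    Subtype.val_injective.comp (mulEquivOfCyclicCardEq hcard).injective⟩

/-- A `p`-group of maximal order that embeds in a finite group is isomorphic to its Sylow
subgroups. -/
theorem Sylow.nonempty_mulEquiv_of_injective {G K : Type*} [Group G] [Finite G] [Group K] {p : ℕ}
    [Fact p.Prime] (P : Sylow p G) {f : K →* G} (hf : Function.Injective f)
    (hK : Nat.card K = p ^ (Nat.card G).factorization p) : Nonempty (P ≃* K) := by
  have hcard : Nat.card f.range = p ^ (Nat.card G).factorization p := by
    rw [← hK, Nat.card_congr (MonoidHom.ofInjective hf).toEquiv]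
  exact ⟨(P.equiv (Sylow.ofCard f.range hcard)).trans (MonoidHom.ofInjective hf).symm⟩

theorem stmt9 (p r q s : ℕ) (hp : p.Prime) (hodd : p ≠ 2) (hr : 1 ≤ r)
    (hq : q = p ^ r) (hq4 : q % 4 = 1) (hs : s = padicValNat 2 (q - 1))
    (F : Type*) [Field F] [Fintype F] (hF : Fintype.card F = q)
    (n : ℕ) (hn : 1 ≤ n)
    (P : Sylow 2 (Matrix.GeneralLinearGroup (Fin n) F))
    (Q : Sylow 2 (Equiv.Perm (Fin n))) :
    Nonempty
      (↥P ≃*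
        SemidirectProduct (Fin n → Multiplicative (ZMod (2 ^ s))) ↥Q
          ((permAction n (Multiplicative (ZMod (2 ^ s)))).comp
            (Q : Subgroup (Equiv.Perm (Fin n))).subtype)) := by
  have hq1 : 1 < q := hF ▸ Fintype.one_lt_card
  have hdvd : 2 ^ s ∣ Nat.card Fˣ := by
    rw [Nat.card_units, Nat.card_eq_fintype_card, hF, hs]
    exact pow_padicValNat_dvd
  obtain ⟨c, hc⟩ := IsCyclic.exists_injective_zmod hdvd
  refine P.nonempty_mulEquiv_of_injective
    (f := (monomialHom c (Q : Subgroup (Equiv.Perm (Fin n)))).toHomUnits) ?_ ?_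
  · intro x y hxy
    exact monomialHom_injective hc _ (congrArg Units.val hxy)
  · have hQ : Nat.card ↥Q = 2 ^ (Nat.card (Equiv.Perm (Fin n))).factorization 2 :=
      Q.card_eq_multiplicity
    rw [SemidirectProduct.card, hQ, Nat.card_perm, Matrix.card_GL_field, hF,
      factorization_two_prod_pow_sub_pow hq4 hq1, ← hs, Nat.card_pi]
    simp [pow_add, ← pow_mul, mul_comm]
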